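/- arXiv:1504.00168 — 3 statements merged into one kernel-verified Lean document; each statement's English description precedes it below -/
import Mathlib

section
/- Let $(\mathfrak a_i)_{i\ge 1}$ be a sequence of ideals of $R$ such that for each $n \ge 1$ one has $\mathfrak a_i \subseteq \mathfrak m^n$ for all but finitely many $i$. Then the $\mathfrak m$-adic completion of $M = \bigoplus_{i=1}^{\infty} R/\mathfrak a_i$ is pure-injective. In particular this holds for $M = \bigoplus_{i=1}^{\infty} R/\mathfrak m^i$. -/
/- Throughout, `(R, 𝔪)` is a commutative noetherian local ring and all modules are `R`-modules.
`AdicCompletion (maximalIdeal R) M` is the `𝔪`-adic completion `lim M/𝔪^n M` and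
`IsHausdorff (maximalIdeal R) M` says that `M` is (`𝔪`-adically) separated. -/

open TensorProduct IsLocalRing

universe u

section Definitions

variable (R : Type u) [CommRing R]

/-- A linear map is a *pure monomorphism* if it is injective and remains injective after
tensoring with an arbitrary module. -/
def IsPureMono {M N : Type u} [AddCommGroup M] [Module R M] [AddCommGroup N] [Module R N]
    (f : M →ₗ[R] N) : Prop :=
  Function.Injective f ∧
    ∀ (X : Type u) [AddCommGroup X] [Module R X], Function.Injective (LinearMap.lTensor X f)

/-- A module `N` is *pure-injective* if every pure monomorphism out of `N` splits. -/
def IsPureInjective (N : Type u) [AddCommGroup N] [Module R N] : Prop :=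
  ∀ (Y : Type u) [AddCommGroup Y] [Module R Y] (f : N →ₗ[R] Y),
    IsPureMono R f → ∃ g : Y →ₗ[R] N, g ∘ₗ f = LinearMap.id

/-- A submodule `A ⊆ B` is *pure* if its inclusion is a pure monomorphism. -/
def IsPureSubmodule {B : Type u} [AddCommGroup B] [Module R B] (A : Submodule R B) : Prop :=
  IsPureMono R A.subtype

/-- An extension `A ⊆ B` is *pure-essential* if `A` is pure in `B` and for every submodule
`X ⊆ B` with `X ⊓ A = 0` such that `(X ⊕ A)/X` is pure in `B/X`, one has `X = 0`. -/
def IsPureEssential {B : Type u} [AddCommGroup B] [Module R B] (A : Submodule R B) : Prop :=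
  IsPureSubmodule R A ∧
    ∀ X : Submodule R B, X ⊓ A = ⊥ → IsPureMono R (X.mkQ ∘ₗ A.subtype) → X = ⊥

/-- An extension `A ⊆ B` is *strictly pure-essential* if it is pure-essential and for every
extension `B ⊆ Y` in which `A` is pure in `Y`, also `B` is pure in `Y`. -/
def IsStrictlyPureEssential {B : Type u} [AddCommGroup B] [Module R B] (A : Submodule R B) :
    Prop :=
  IsPureEssential R A ∧
    ∀ (Y : Type u) [AddCommGroup Y] [Module R Y] (g : B →ₗ[R] Y),
      Function.Injective g → IsPureMono R (g ∘ₗ A.subtype) → IsPureMono R g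

/-- A module `M` over a local ring is *totally separated* if `X ⊗[R] M` is `𝔪`-adically
separated for every finitely generated `R`-module `X`. -/
def IsTotallySeparatedModule [IsLocalRing R] (M : Type u) [AddCommGroup M] [Module R M] :
    Prop :=
  ∀ (X : Type u) [AddCommGroup X] [Module R X] [Module.Finite R X],
    IsHausdorff (maximalIdeal R) (X ⊗[R] M)

end Definitions

section PureInjective

variable {R : Type u} [CommRing R]

/-- A finite system of linear equations with constants in a pure submodule that is solvable in the
ambient module is solvable in the submodule. -/
theorem IsPureMono.exists_solution {N Y : Type u} [AddCommGroup N] [Module R N] [AddCommGroup Y]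
    [Module R Y] {f : N →ₗ[R] Y} (hf : IsPureMono R f) (S : Finset ((Y →₀ R) × N))
    (hS : ∀ s ∈ S, Finsupp.linearCombination R id s.1 = f s.2) :
    ∃ h : Y → N, ∀ s ∈ S, Finsupp.linearCombination R h s.1 = s.2 := by
  classical
  let A : (Y →₀ R) →ₗ[R] (S →₀ R) :=
    Finsupp.linearCombination R fun y => ∑ s : S, Finsupp.single s (s.1.1 y)
  have hAy : ∀ y (s : S), A (Finsupp.single y 1) s = s.1.1 y := by
    intro y s
    simp [A, Finsupp.finsetSum_apply, Finsupp.single_apply]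
  let q := (LinearMap.range A).mkQ
  have hAq : Function.Exact A q := LinearMap.exact_map_mkQ_range A
  have hq : Function.Surjective q := Submodule.mkQ_surjective _
  let t : (S →₀ R) ⊗[R] N := ∑ s : S, Finsupp.single s 1 ⊗ₜ s.1.2
  have ht : LinearMap.rTensor N q t = 0 := by
    apply hf.2
    rw [map_zero, ← LinearMap.comp_apply, LinearMap.lTensor_comp_rTensor,
      ← LinearMap.rTensor_comp_lTensor, LinearMap.comp_apply]
    have hw : LinearMap.lTensor _ f t =
        LinearMap.rTensor Y A (∑ y ∈ S.biUnion fun s => s.1.support, Finsupp.single y 1 ⊗ₜ y) := by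
      apply (TensorProduct.finsuppScalarLeft R Y S).injective
      ext s
      simp only [t, map_sum, LinearMap.lTensor_tmul, LinearMap.rTensor_tmul,
        Finsupp.finsetSum_apply, TensorProduct.finsuppScalarLeft_apply_tmul_apply, hAy]
      rw [Finset.sum_eq_single s (by intro b _ hb; simp [hb]) (by simp)]
      rw [← hS s.1 s.2, Finsupp.linearCombination_apply, Finsupp.sum]
      simp only [Finsupp.single_eq_same, one_smul, id]
      exact Finset.sum_subset (Finset.subset_biUnion_of_mem (fun s => s.1.support) s.2)
        fun y _ hy => by simp [Finsupp.notMem_support_iff.1 hy]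
    rw [hw, (rTensor_exact Y hAq hq).apply_apply_eq_zero]
  obtain ⟨w, hw⟩ := (rTensor_exact N hAq hq t).1 ht
  have key : ∀ (w : (Y →₀ R) ⊗[R] N) (s : S),
      TensorProduct.finsuppScalarLeft R N S (LinearMap.rTensor N A w) s =
        Finsupp.linearCombination R (TensorProduct.finsuppScalarLeft R N Y w) s.1.1 := by
    intro w s
    induction w with
    | zero => simp
    | add x y hx hy =>
      simp only [map_add, Finsupp.add_apply, hx, hy]
      simp [Finsupp.linearCombination_apply, Finsupp.sum, Finset.sum_add_distrib]
    | tmul p n =>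
      induction p using Finsupp.induction_linear with
      | zero => simp
      | add x y hx hy =>
        simp only [add_tmul, map_add, Finsupp.add_apply, hx, hy]
        simp [Finsupp.linearCombination_apply, Finsupp.sum, Finset.sum_add_distrib]
      | single y r =>
        have : Finsupp.single y r = r • Finsupp.single y (1 : R) := by simp
        rw [this, LinearMap.rTensor_tmul, map_smul,
          TensorProduct.finsuppScalarLeft_apply_tmul_apply, Finsupp.smul_apply, hAy,
          Finsupp.linearCombination_apply, Finsupp.sum]
        simp only [TensorProduct.finsuppScalarLeft_apply_tmul_apply]
        by_cases hy : y ∈ s.1.1.support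
        · rw [Finset.sum_eq_single y (by intro b _ hb; simp [hb]) (fun h => absurd hy h)]
          simp [smul_smul, mul_comm]
        · rw [Finset.sum_eq_zero]
          · simp [Finsupp.notMem_support_iff.1 hy]
          · intro z hz
            have : z ≠ y := fun h => hy (h ▸ hz)
            simp [this]
  refine ⟨TensorProduct.finsuppScalarLeft R N Y w, fun s hs => ?_⟩
  have h := key w ⟨s, hs⟩
  rw [hw] at h
  rw [← h]
  simp only [t, map_sum, Finsupp.finsetSum_apply,
    TensorProduct.finsuppScalarLeft_apply_tmul_apply]
  rw [Finset.sum_eq_single ⟨s, hs⟩ (by intro b _ hb; simp [hb]) (by simp)]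
  simp

/-- The affine subspace of solutions of a linear equation. -/
def LinearMap.solutions {V W : Type*} [AddCommGroup V] [Module R V] [AddCommGroup W] [Module R W]
    (L : V →ₗ[R] W) (b : W) : AffineSubspace R V where
  carrier := {x | L x = b}
  smul_vsub_vadd_mem' := by
    intro r p q s hp hq hs
    simp only [Set.mem_ofPred_eq] at *
    simp [hp, hq, hs]

theorem LinearMap.mem_solutions {V W : Type*} [AddCommGroup V] [Module R V] [AddCommGroup W]
    [Module R W] {L : V →ₗ[R] W} {b : W} {x : V} : x ∈ L.solutions b ↔ L x = b :=
  Iff.rfl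

/-- Affine conditions on a product of artinian modules, each involving only finitely many
coordinates, can be satisfied simultaneously as soon as any finitely many of them can. -/
theorem AffineSubspace.exists_forall_mem_of_isArtinian {ι : Type*} {M : ι → Type*}
    [∀ i, AddCommGroup (M i)] [∀ i, Module R (M i)] [∀ i, IsArtinian R (M i)]
    {κ : Type*} (C : κ → AffineSubspace R (∀ i, M i))
    (hC : ∀ c, ∃ s : Finset ι, ∀ x y : ∀ i, M i, (∀ i ∈ s, x i = y i) → x ∈ C c → y ∈ C c)
    (hfin : ∀ t : Finset κ, ∃ x, ∀ c ∈ t, x ∈ C c) :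
    ∃ x, ∀ c, x ∈ C c := by
  classical
  let S : Set (Set (AffineSubspace R (∀ i, M i))) :=
    {F | F.Nonempty ∧ DirectedOn (· ≥ ·) F ∧ ⊥ ∉ F}
  let F₀ : Set (AffineSubspace R (∀ i, M i)) := Set.range fun t : Finset κ => t.inf C
  have hF₀ : F₀ ∈ S := by
    refine ⟨Set.range_nonempty _, ?_, ?_⟩
    · rintro _ ⟨t, rfl⟩ _ ⟨t', rfl⟩
      exact ⟨_, ⟨t ∪ t', rfl⟩, Finset.inf_mono Finset.subset_union_left,
        Finset.inf_mono Finset.subset_union_right⟩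
    · rintro ⟨t, ht⟩
      obtain ⟨x, hx⟩ := hfin t
      have : AffineSubspace.mk' x (⊥ : Submodule R (∀ i, M i)) ≤ t.inf C := by
        refine Finset.le_inf fun c hc y hy => ?_
        have : y = x := by simpa [AffineSubspace.mem_mk', sub_eq_zero] using hy
        subst this
        exact hx c hc
      simp only at ht
      rw [ht] at this
      exact this (AffineSubspace.self_mem_mk' x ⊥)
  obtain ⟨F, hF₀F, hF⟩ := zorn_subset_nonempty S (by
    intro c hc hchain hne
    refine ⟨⋃₀ c, ⟨?_, ?_, ?_⟩, fun s hs => Set.subset_sUnion_of_mem hs⟩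
    · obtain ⟨s, hs⟩ := hne
      obtain ⟨x, hx⟩ := (hc hs).1
      exact ⟨x, s, hs, hx⟩
    · rintro A ⟨s, hs, hA⟩ B ⟨s', hs', hB⟩
      obtain ⟨w, hw, hsw, hsw'⟩ := hchain.directedOn s hs s' hs'
      obtain ⟨D, hD, hDA, hDB⟩ := (hc hw).2.1 A (hsw hA) B (hsw' hB)
      exact ⟨D, ⟨w, hw, hD⟩, hDA, hDB⟩
    · rintro ⟨s, hs, h⟩
      exact (hc hs).2.2 h) F₀ hF₀
  obtain ⟨hFne, hFdir, hFbot⟩ := hF.prop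
  -- each coordinate is determined on some member of `F`
  have key : ∀ i, ∃ m : M i, ∃ A ∈ F, ∀ x ∈ A, x i = m := by
    intro i
    let p : (∀ i, M i) →ᵃ[R] M i := (LinearMap.proj i : (∀ i, M i) →ₗ[R] M i).toAffineMap
    have hp : ∀ x, p x = x i := fun x => rfl
    obtain ⟨_, ⟨A, hA, rfl⟩, hmin⟩ := WellFounded.has_min
      (IsWellFounded.wf : WellFounded ((· < ·) : Submodule R (M i) → _ → Prop))
      ((fun A : AffineSubspace R (∀ i, M i) => (A.map p).direction) '' F) (hFne.image _)
    have hnonempty : ∀ B ∈ F, (B : Set (∀ i, M i)).Nonempty := fun B hB =>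
      (AffineSubspace.nonempty_iff_ne_bot B).2 fun h => hFbot (h ▸ hB)
    obtain ⟨a, ha⟩ := hnonempty A hA
    let E : AffineSubspace R (∀ i, M i) := (AffineSubspace.mk' (a i) ⊥).comap p
    have hE : ∀ x, x ∈ E ↔ x i = a i := by
      intro x
      simp [E, AffineSubspace.mem_comap, AffineSubspace.mem_mk', sub_eq_zero, hp]
    have hmeet : ∀ B ∈ F, ∃ x ∈ B, x i = a i := by
      intro B hB
      obtain ⟨D, hD, hDA, hDB⟩ := hFdir A hA B hB
      have hle : D.map p ≤ A.map p := AffineSubspace.map_mono p hDA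
      have hdir : (D.map p).direction = (A.map p).direction := by
        by_contra hne
        exact hmin _ ⟨D, hD, rfl⟩ (lt_of_le_of_ne (AffineSubspace.direction_le hle) hne)
      have heq := AffineSubspace.eq_of_direction_eq_of_nonempty_of_le hdir
        (by simpa using hnonempty D hD) hle
      have : a i ∈ D.map p := heq ▸ AffineSubspace.mem_map_of_mem p ha
      obtain ⟨x, hx, hxa⟩ := (AffineSubspace.mem_map).1 this
      exact ⟨x, hDB hx, hxa⟩
    have hmem : F ∪ (· ⊓ E) '' F ∈ S := by
      refine ⟨hFne.mono Set.subset_union_left, ?_, ?_⟩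
      · have haux : ∀ B ∈ F ∪ (· ⊓ E) '' F, ∃ B' ∈ F, B' ⊓ E ≤ B := by
          rintro B (hB | ⟨B', hB', rfl⟩)
          · exact ⟨B, hB, inf_le_left⟩
          · exact ⟨B', hB', le_rfl⟩
        intro B hB B' hB'
        obtain ⟨X, hX, hXB⟩ := haux B hB
        obtain ⟨X', hX', hXB'⟩ := haux B' hB'
        obtain ⟨D, hD, hDX, hDX'⟩ := hFdir X hX X' hX'
        exact ⟨D ⊓ E, Or.inr ⟨D, hD, rfl⟩, (inf_le_inf_right E hDX).trans hXB,
          (inf_le_inf_right E hDX').trans hXB'⟩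
      · rintro (h | ⟨B, hB, h⟩)
        · exact hFbot h
        · obtain ⟨x, hx, hxa⟩ := hmeet B hB
          have hmem : x ∈ B ⊓ E := ⟨hx, (hE x).2 hxa⟩
          simp only at h
          rw [h] at hmem
          exact hmem
    have hAE : A ⊓ E ∈ F := hF.le_of_ge hmem Set.subset_union_left (Or.inr ⟨A, hA, rfl⟩)
    exact ⟨a i, A ⊓ E, hAE, fun x hx => (hE x).1 hx.2⟩
  choose g A hA hg using key
  refine ⟨g, fun c => ?_⟩
  obtain ⟨s, hs⟩ := hC c
  have hcF : C c ∈ F := hF₀F ⟨{c}, by simp⟩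
  have hex : ∀ s : Finset ι, ∃ D ∈ F, D ≤ C c ∧ ∀ i ∈ s, D ≤ A i := by
    intro s
    induction s using Finset.induction_on with
    | empty => exact ⟨C c, hcF, le_rfl, by simp⟩
    | insert i s _ ih =>
      obtain ⟨D, hD, hDc, hDs⟩ := ih
      obtain ⟨D', hD', h₁, h₂⟩ := hFdir D hD (A i) (hA i)
      refine ⟨D', hD', h₁.trans hDc, fun j hj => ?_⟩
      rcases Finset.mem_insert.1 hj with rfl | hj
      · exact h₂
      · exact h₁.trans (hDs j hj)
  obtain ⟨D, hD, hDc, hDs⟩ := hex s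
  obtain ⟨x, hx⟩ := (AffineSubspace.nonempty_iff_ne_bot D).2 fun h => hFbot (h ▸ hD)
  exact hs x g (fun i hi => hg i x (hDs i hi hx)) (hDc hx)

theorem isArtinian_quotient_maximalIdeal_pow_smul [IsNoetherianRing R] [IsLocalRing R]
    (M : Type*) [AddCommGroup M] [Module R M] [Module.Finite R M] (n : ℕ) :
    IsArtinian R (M ⧸ (maximalIdeal R ^ n • ⊤ : Submodule R M)) := by
  have : IsArtinianRing (R ⧸ maximalIdeal R ^ n) := by
    rcases Nat.eq_zero_or_pos n with rfl | hn
    · have : Subsingleton (R ⧸ maximalIdeal R ^ 0) := by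
        rw [pow_zero, Ideal.one_eq_top]
        exact Ideal.Quotient.subsingleton_iff.2 rfl
      infer_instance
    · apply IsLocalRing.quotient_artinian_of_mem_minimalPrimes_of_isLocalRing
      exact ⟨⟨inferInstance, Ideal.pow_le_self hn.ne'⟩, fun J hJ _ => hJ.1.le_of_pow_le hJ.2⟩
  have : Module.Finite (R ⧸ maximalIdeal R ^ n)
      (M ⧸ (maximalIdeal R ^ n • ⊤ : Submodule R M)) :=
    Module.Finite.of_restrictScalars_finite R _ _
  exact isArtinian_of_surjective_algebraMap (R := R ⧸ maximalIdeal R ^ n)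
    Ideal.Quotient.mk_surjective

theorem IsPureMono.exists_adicCompletion_extension [IsNoetherianRing R] [IsLocalRing R]
    {N Y : Type u} [AddCommGroup N] [Module R N] [AddCommGroup Y] [Module R Y]
    {f : N →ₗ[R] Y} (hf : IsPureMono R f) {M : Type*} [AddCommGroup M] [Module R M]
    [Module.Finite R M] (v : N →ₗ[R] AdicCompletion (maximalIdeal R) M) :
    ∃ h : Y →ₗ[R] AdicCompletion (maximalIdeal R) M, h ∘ₗ f = v := by
  classical
  have := isArtinian_quotient_maximalIdeal_pow_smul (R := R) M
  let I := maximalIdeal R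
  let Rel := {s : (Y →₀ R) × N // Finsupp.linearCombination R id s.1 = f s.2}
  let V := ∀ i : Y × ℕ, M ⧸ (I ^ i.2 • ⊤ : Submodule R M)
  let pr : ∀ (n : ℕ) (y : Y), V →ₗ[R] M ⧸ (I ^ n • ⊤ : Submodule R M) := fun n y =>
    LinearMap.proj (φ := fun i : Y × ℕ => M ⧸ (I ^ i.2 • ⊤ : Submodule R M)) (y, n)
  have hpr : ∀ n y (x x' : V), x (y, n) = x' (y, n) → pr n y x = pr n y x' := fun _ _ _ _ h => h
  let C : Rel × ℕ ⊕ Y × {d : ℕ × ℕ // d.1 ≤ d.2} → AffineSubspace R V := Sum.elim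
    (fun c => (Finsupp.linearCombination R (pr c.2) c.1.1.1).solutions
      (AdicCompletion.eval I M c.2 (v c.1.1.2)))
    (fun c => (AdicCompletion.transitionMap I M c.2.2 ∘ₗ pr c.2.1.2 c.1 -
      pr c.2.1.1 c.1).solutions 0)
  have hC₁ : ∀ (s : Rel) n (x : V), x ∈ C (Sum.inl (s, n)) ↔
      Finsupp.linearCombination R (pr n · x) s.1.1 = AdicCompletion.eval I M n (v s.1.2) := by
    intro s n x
    have h : Finsupp.linearCombination R (pr n · x) s.1.1 =
        Finsupp.linearCombination R (pr n) s.1.1 x :=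
      (Finsupp.apply_linearCombination R (LinearMap.applyₗ x) (pr n) s.1.1).symm
    rw [h]
    rfl
  have hC₂ : ∀ (y : Y) (m n : ℕ) (hmn : m ≤ n) (x : V), x ∈ C (Sum.inr (y, ⟨(m, n), hmn⟩)) ↔
      AdicCompletion.transitionMap I M hmn (pr n y x) = pr m y x := fun _ _ _ _ _ =>
    LinearMap.mem_solutions.trans sub_eq_zero
  obtain ⟨x, hx⟩ := AffineSubspace.exists_forall_mem_of_isArtinian C (by
    rintro (⟨s, n⟩ | ⟨y, ⟨⟨m, n⟩, hmn⟩⟩)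
    · refine ⟨s.1.1.support.image fun y => (y, n), fun x x' h hx => ?_⟩
      rw [hC₁] at hx ⊢
      rw [← hx, Finsupp.linearCombination_apply, Finsupp.linearCombination_apply]
      exact Finset.sum_congr rfl fun y hy =>
        congrArg (_ • ·) (hpr n y x x' (h _ (Finset.mem_image_of_mem _ hy))).symm
    · refine ⟨{(y, n), (y, m)}, fun x x' h hx => ?_⟩
      rw [hC₂] at hx ⊢
      rw [← hpr n y x x' (h _ (by simp)), ← hpr m y x x' (h _ (by simp)), hx]) (by
    intro t
    obtain ⟨h, hh⟩ := hf.exists_solution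
      (t.preimage Sum.inl Sum.inl_injective.injOn |>.image fun c => c.1.1) (by
        intro s hs
        obtain ⟨c, -, rfl⟩ := Finset.mem_image.1 hs
        exact c.1.2)
    refine ⟨fun i => AdicCompletion.eval I M i.2 (v (h i.1)), ?_⟩
    rintro (⟨s, n⟩ | ⟨y, ⟨⟨m, n⟩, hmn⟩⟩) hc
    · rw [hC₁]
      have h' := hh s.1 (Finset.mem_image.2 ⟨(s, n), by simpa using hc, rfl⟩)
      rw [← h', ← LinearMap.comp_apply, Finsupp.apply_linearCombination]
      rfl
    · rw [hC₂]
      exact AdicCompletion.transitionMap_comp_eval_apply _ _ hmn _)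
  have hrel : ∀ (p : Y →₀ R) (z : N), Finsupp.linearCombination R id p = f z → ∀ n,
      Finsupp.linearCombination R (pr n · x) p = AdicCompletion.eval I M n (v z) :=
    fun p z hpz n => (hC₁ ⟨(p, z), hpz⟩ n x).1 (hx _)
  refine ⟨{ toFun := fun y => ⟨fun n => pr n y x, fun {m n} hmn => ?_⟩
            map_add' := fun y y' => ?_
            map_smul' := fun r y => ?_ }, ?_⟩
  · exact (hC₂ y m n hmn x).1 (hx _)
  · refine AdicCompletion.ext fun n => ?_
    have := hrel (Finsupp.single (y + y') 1 - Finsupp.single y 1 - Finsupp.single y' 1) 0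
      (by simp) n
    simp only [map_sub, Finsupp.linearCombination_single, one_smul, map_zero] at this
    exact sub_eq_zero.1 ((sub_sub _ _ _).symm.trans this)
  · refine AdicCompletion.ext fun n => ?_
    have := hrel (Finsupp.single (r • y) 1 - Finsupp.single y r) 0 (by simp) n
    simp only [map_sub, Finsupp.linearCombination_single, one_smul, map_zero,
      sub_eq_zero] at this
    exact this
  · refine LinearMap.ext fun z => AdicCompletion.ext fun n => ?_
    have := hrel (Finsupp.single (f z) 1) z (by simp) n
    simp only [Finsupp.linearCombination_single, one_smul] at this
    exact this

theorem Submodule.map_mem_smul_top {A B : Type*} [AddCommGroup A] [Module R A] [AddCommGroup B]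
    [Module R B] (f : A →ₗ[R] B) {I : Ideal R} {x : A} (hx : x ∈ (I • ⊤ : Submodule R A)) :
    f x ∈ (I • ⊤ : Submodule R B) := by
  have := Submodule.mem_map_of_mem (f := f) hx
  rw [Submodule.map_smul''] at this
  exact Submodule.smul_mono le_rfl le_top this

theorem Submodule.mem_smul_top_pi {ι : Type*} {M : ι → Type*} [∀ i, AddCommGroup (M i)]
    [∀ i, Module R (M i)] {I : Ideal R} (hI : I.FG) (q : ∀ i, M i)
    (hq : ∀ i, q i ∈ (I • ⊤ : Submodule R (M i))) : q ∈ (I • ⊤ : Submodule R (∀ i, M i)) := by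
  induction I, hI using Submodule.fg_induction generalizing q with
  | singleton r =>
    have h : ∀ i, ∃ y : M i, r • y = q i := fun i => by
      simpa [Submodule.ideal_span_singleton_smul, Submodule.mem_smul_pointwise_iff_exists]
        using hq i
    choose y hy using h
    have : q = r • y := funext fun i => (hy i).symm
    rw [this]
    exact Submodule.smul_mem_smul (Submodule.mem_span_singleton_self r) trivial
  | sup I₁ I₂ _ _ h₁ h₂ =>
    simp only [Submodule.sup_smul, Submodule.mem_sup] at hq
    choose y hy z hz hyz using hq
    rw [← funext hyz, Submodule.sup_smul]
    exact Submodule.add_mem_sup (h₁ y hy) (h₂ z hz)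

theorem AdicCompletion.pi_bijective {ι : Type*} (M : ι → Type*) [∀ i, AddCommGroup (M i)]
    [∀ i, Module R (M i)] {I : Ideal R} (hI : I.FG) :
    Function.Bijective (AdicCompletion.pi I M) := by
  have key : ∀ n (q : ∀ i, M i), (∀ i, q i ∈ (I ^ n • ⊤ : Submodule R (M i))) →
      q ∈ (I ^ n • ⊤ : Submodule R (∀ i, M i)) := fun n q =>
    Submodule.mem_smul_top_pi (hI.pow (n := n)) q
  constructor
  · rw [injective_iff_map_eq_zero]
    intro x hx
    induction x using AdicCompletion.induction_on with | _ a
    refine AdicCompletion.ext fun n => (Submodule.Quotient.mk_eq_zero _).2 (key n _ fun i => ?_)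
    exact (Submodule.Quotient.mk_eq_zero _).1
      (congrArg (AdicCompletion.eval I (M i) n) (congrFun hx i))
  · intro x
    choose a ha using fun i => AdicCompletion.mk_surjective I (M i) (x i)
    refine ⟨AdicCompletion.mk I _ ⟨fun n i => a i n, fun {m n} hmn => ?_⟩, ?_⟩
    · rw [SModEq.sub_mem]
      exact key m _ fun i => SModEq.sub_mem.1 ((a i).property hmn)
    · funext i
      rw [← ha i]
      rfl

theorem AdicCompletion.map_bijective {A B : Type*} [AddCommGroup A] [Module R A] [AddCommGroup B]
    [Module R B] {I : Ideal R} {f : A →ₗ[R] B}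
    (hinj : ∀ n x, f x ∈ (I ^ n • ⊤ : Submodule R B) → x ∈ (I ^ n • ⊤ : Submodule R A))
    (hsurj : ∀ b, ∃ x, b - f x ∈ (I • ⊤ : Submodule R B)) :
    Function.Bijective (AdicCompletion.map I f) := by
  have hsurj' : ∀ n b, ∃ x, b - f x ∈ (I ^ n • ⊤ : Submodule R B) := by
    intro n
    induction n with
    | zero => exact fun b => ⟨0, by simp⟩
    | succ n ih =>
      have aux : ∀ b ∈ (I ^ n • ⊤ : Submodule R B),
          ∃ x, b - f x ∈ (I ^ (n + 1) • ⊤ : Submodule R B) := by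
        intro b hb
        induction hb using Submodule.smul_induction_on' with
        | smul r hr b _ =>
          obtain ⟨x, hx⟩ := hsurj b
          refine ⟨r • x, ?_⟩
          rw [map_smul, ← smul_sub, pow_succ, ← smul_eq_mul, Submodule.smul_assoc]
          exact Submodule.smul_mem_smul hr hx
        | add b _ c _ hb hc =>
          obtain ⟨x, hx⟩ := hb
          obtain ⟨y, hy⟩ := hc
          refine ⟨x + y, ?_⟩
          rw [map_add, add_sub_add_comm]
          exact add_mem hx hy
      intro b
      obtain ⟨x, hx⟩ := ih b
      obtain ⟨y, hy⟩ := aux _ hx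
      exact ⟨x + y, by rwa [map_add, ← sub_sub]⟩
  constructor
  · rw [injective_iff_map_eq_zero]
    intro x hx
    induction x using AdicCompletion.induction_on with | _ a
    refine AdicCompletion.ext fun n => (Submodule.Quotient.mk_eq_zero _).2 (hinj n _ ?_)
    exact (Submodule.Quotient.mk_eq_zero _).1 (congrArg (AdicCompletion.eval I B n) hx)
  · intro x
    obtain ⟨b, rfl⟩ := AdicCompletion.mk_surjective I B x
    choose a ha using fun n => hsurj' n (b n)
    refine ⟨AdicCompletion.mk I A ⟨a, fun {m n} hmn => ?_⟩, ?_⟩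
    · rw [SModEq.sub_mem]
      apply hinj
      have h₁ := ha m
      have h₂ := Submodule.smul_mono_left (Ideal.pow_le_pow_right hmn) (ha n)
      have h₃ := SModEq.sub_mem.1 (b.property hmn)
      have := add_mem (sub_mem h₃ h₁) h₂
      rw [map_sub]
      convert this using 1
      abel
    · refine AdicCompletion.ext fun n => ((Submodule.Quotient.eq _).2 ?_)
      have := neg_mem (ha n)
      rwa [neg_sub] at this

theorem Ideal.Quotient.mkQ_mem_smul_top_iff {I a : Ideal R} {r : R} :
    a.mkQ r ∈ (I • ⊤ : Submodule R (R ⧸ a)) ↔ r ∈ a ⊔ I := by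
  have : (I • ⊤ : Submodule R (R ⧸ a)) = Submodule.map a.mkQ I := by
    rw [← Submodule.range_mkQ a, ← Submodule.map_top, ← Submodule.map_smul'']
    simp
  rw [this, ← Submodule.mem_comap, Submodule.comap_map_mkQ]

/-- If the vectors `r j` are linearly independent modulo `𝔪`, then a linear combination of them with
coefficients in `𝔪 ^ n` that vanishes modulo `𝔪 ^ (n + 1)` has coefficients in `𝔪 ^ (n + 1)`. -/
theorem IsLocalRing.mem_maximalIdeal_pow_of_sum_mul_mem [IsLocalRing R] {J T : Type*}
    (r : J → T → R)
    (h : ∀ s : J →₀ R, (∀ t, s.sum (fun j c => c * r j t) ∈ maximalIdeal R) →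
      ∀ j, s j ∈ maximalIdeal R) (n : ℕ) (c : J →₀ R)
    (hc : ∀ t, c.sum (fun j c => c * r j t) ∈ maximalIdeal R ^ (n + 1))
    (hcn : ∀ j, c j ∈ maximalIdeal R ^ n) (j : J) : c j ∈ maximalIdeal R ^ (n + 1) := by
  classical
  let I := maximalIdeal R
  let _ : Field (R ⧸ I) := Ideal.Quotient.field I
  let N : Ideal R := I ^ n
  let C : J →₀ N := Finsupp.onFinset c.support (fun j => ⟨c j, hcn j⟩) fun j hj =>
    Finsupp.mem_support_iff.2 fun h0 => hj (Subtype.ext h0)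
  have hC : ∀ j, (C j : R) = c j := fun j => rfl
  have hmk : ∀ x : N, (I • ⊤ : Submodule R N).mkQ x = 0 ↔ (x : R) ∈ I ^ (n + 1) := fun x => by
    rw [Submodule.mkQ_apply, Submodule.Quotient.mk_eq_zero, Submodule.mem_smul_top_iff, pow_succ',
      smul_eq_mul]
  rw [← hC, ← hmk, ← Module.forall_dual_apply_eq_zero_iff (R ⧸ I)]
  intro φ
  let Λ : N →ₗ[R] R ⧸ I := φ.restrictScalars R ∘ₗ (I • ⊤ : Submodule R N).mkQ
  change Λ (C j) = 0
  obtain ⟨s, hs⟩ := Finsupp.mapRange_surjective (Ideal.Quotient.mk I) (map_zero _)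
    Ideal.Quotient.mk_surjective (C.mapRange Λ (map_zero _))
  replace hs : ∀ j, Ideal.Quotient.mk I (s j) = Λ (C j) := fun j => DFunLike.congr_fun hs j
  rw [← hs, Ideal.Quotient.eq_zero_iff_mem]
  refine h s (fun t => ?_) j
  rw [← Ideal.Quotient.eq_zero_iff_mem]
  have hsum : s.sum (fun j c => c * r j t) = ∑ j ∈ s.support ∪ c.support, s j * r j t :=
    Finsupp.sum_of_support_subset _ Finset.subset_union_left _ (by simp)
  have hsum' : c.sum (fun j c => c * r j t) = ∑ j ∈ s.support ∪ c.support, c j * r j t :=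
    Finsupp.sum_of_support_subset _ Finset.subset_union_right _ (by simp)
  have hval : ((∑ j ∈ s.support ∪ c.support, r j t • C j : N) : R) =
      c.sum (fun j c => c * r j t) := by
    rw [hsum', AddSubmonoidClass.coe_finsetSum]
    exact Finset.sum_congr rfl fun j _ => mul_comm _ _
  have hΛ : Λ (∑ j ∈ s.support ∪ c.support, r j t • C j) = 0 := by
    change φ _ = 0
    rw [(hmk _).2 (hval ▸ hc t), map_zero]
  rw [hsum, map_sum, ← hΛ, map_sum]
  refine Finset.sum_congr rfl fun j _ => ?_
  rw [map_smul, ← hs, mul_comm, map_mul, Algebra.smul_def]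
  rfl

theorem DFinsupp.mem_smul_top {ι : Type*} {M : ι → Type*} [∀ i, AddCommGroup (M i)]
    [∀ i, Module R (M i)] {I : Ideal R} (d : Π₀ i, M i)
    (hd : ∀ i, d i ∈ (I • ⊤ : Submodule R (M i))) : d ∈ (I • ⊤ : Submodule R (Π₀ i, M i)) := by
  classical
  rw [← DFinsupp.sum_single (f := d)]
  exact Submodule.sum_mem _ fun i _ =>
    Submodule.map_mem_smul_top (DFinsupp.lsingle i : M i →ₗ[R] Π₀ i, M i) (hd i)

theorem Finsupp.mem_smul_top {J : Type*} {I : Ideal R} (c : J →₀ R) (hc : ∀ j, c j ∈ I) :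
    c ∈ (I • ⊤ : Submodule R (J →₀ R)) := by
  rw [← Finsupp.sum_single c]
  refine Submodule.sum_mem _ fun j _ => ?_
  rw [← mul_one (c j), ← smul_eq_mul, ← Finsupp.smul_single]
  exact Submodule.smul_mem_smul (hc j) trivial

/-- The completion of the inclusion of a direct sum of cyclic modules `R ⧸ a i` into their product
splits, provided that the ideals `a i` converge to zero in the `𝔪`-adic topology. -/
theorem AdicCompletion.exists_retraction_map_coeFnLinearMap [IsNoetherianRing R] [IsLocalRing R]
    {ι : Type*} (a : ι → Ideal R)
    (ha : ∀ n : ℕ, 1 ≤ n → {i | ¬ a i ≤ maximalIdeal R ^ n}.Finite) :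
    ∃ g : AdicCompletion (maximalIdeal R) (∀ i, R ⧸ a i) →ₗ[R]
        AdicCompletion (maximalIdeal R) (Π₀ i, R ⧸ a i),
      ∀ x, g (AdicCompletion.map (maximalIdeal R)
        (DFinsupp.coeFnLinearMap R : (Π₀ i, R ⧸ a i) →ₗ[R] ∀ i, R ⧸ a i) x) = x := by
  classical
  let I := maximalIdeal R
  have hI : I.FG := IsNoetherian.noetherian I
  let _ : Field (R ⧸ I) := Ideal.Quotient.field I
  let incl : (Π₀ i, R ⧸ a i) →ₗ[R] ∀ i, R ⧸ a i := DFinsupp.coeFnLinearMap R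
  let V := ((∀ i, R ⧸ a i) ⧸ incl.range) ⧸
    (I • ⊤ : Submodule R ((∀ i, R ⧸ a i) ⧸ incl.range))
  let π : (∀ i, R ⧸ a i) →ₗ[R] V := Submodule.mkQ _ ∘ₗ incl.range.mkQ
  have hπ_surj : Function.Surjective π :=
    (Submodule.mkQ_surjective _).comp (Submodule.mkQ_surjective _)
  have hπ : ∀ q, π q = 0 ↔ ∃ d, q - incl d ∈ (I • ⊤ : Submodule R (∀ i, R ⧸ a i)) := by
    intro q
    have h₁ : π q = 0 ↔ incl.range.mkQ q ∈
        (I • ⊤ : Submodule R (∀ i, R ⧸ a i)).map incl.range.mkQ := by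
      rw [Submodule.map_smul'', Submodule.map_top, Submodule.range_mkQ]
      exact Submodule.Quotient.mk_eq_zero _
    rw [h₁]
    constructor
    · rintro ⟨y, hy, hyq⟩
      rw [Submodule.mkQ_apply, Submodule.mkQ_apply, Submodule.Quotient.eq] at hyq
      obtain ⟨d, hd⟩ := hyq
      refine ⟨-d, ?_⟩
      rw [map_neg, hd]
      simpa using hy
    · rintro ⟨d, hd⟩
      refine ⟨_, hd, ?_⟩
      rw [map_sub, sub_eq_self, Submodule.mkQ_apply, Submodule.Quotient.mk_eq_zero]
      exact ⟨d, rfl⟩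
  let b := Module.Basis.ofVectorSpace (R ⧸ I) V
  choose e he using fun j => hπ_surj (b j)
  choose r hr using fun j i => Ideal.Quotient.mk_surjective (e j i)
  let L := Finsupp.linearCombination R e
  have hL : ∀ s i, L s i = Ideal.Quotient.mk (a i) (s.sum fun j c => c * r j i) := by
    intro s i
    simp only [L, Finsupp.linearCombination_apply, Finsupp.sum, Finset.sum_apply, map_sum,
      map_mul, hr, Algebra.smul_def]
    rfl
  have hπL : ∀ s, π (L s) = s.sum fun j c => Ideal.Quotient.mk I c • b j := by
    intro s
    simp only [L, Finsupp.linearCombination_apply, Finsupp.sum, map_sum, map_smul, he]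
    rfl
  let Φ : (Π₀ i, R ⧸ a i) × (_ →₀ R) →ₗ[R] ∀ i, R ⧸ a i := incl.coprod L
  have hsurj : ∀ q, ∃ x, q - Φ x ∈ (I • ⊤ : Submodule R (∀ i, R ⧸ a i)) := by
    intro q
    obtain ⟨s, hs⟩ := Finsupp.mapRange_surjective (Ideal.Quotient.mk I)
      (_root_.map_zero _)
      Ideal.Quotient.mk_surjective (b.repr (π q))
    have : π (q - L s) = 0 := by
      rw [map_sub, hπL, ← b.linearCombination_repr (π q), ← hs, Finsupp.linearCombination_apply,
        Finsupp.sum_mapRange_index (by simp), sub_self]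
    obtain ⟨d, hd⟩ := (hπ _).1 this
    refine ⟨(d, s), ?_⟩
    rw [LinearMap.coprod_apply, add_comm, ← sub_sub]
    exact hd
  have hindep : ∀ (T : Set ι) (_ : Tᶜ.Finite) (s : _ →₀ R),
      (∀ t : T, s.sum (fun j c => c * r j t) ∈ I) → ∀ j, s j ∈ I := by
    intro T hT s hs
    have h₀ : π (L s) = 0 := by
      let d : Π₀ i, R ⧸ a i := DFinsupp.mk hT.toFinset fun i => L s i
      refine (hπ _).2 ⟨d, Submodule.mem_smul_top_pi hI _ fun i => ?_⟩
      change L s i - d i ∈ _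
      by_cases hi : i ∈ T
      · have : d i = 0 := by
          rw [DFinsupp.mk_apply, dif_neg (by simpa using hi)]
        rw [this, sub_zero, hL]
        exact Ideal.Quotient.mkQ_mem_smul_top_iff.2 (Ideal.mem_sup_right (hs ⟨i, hi⟩))
      · have : d i = L s i := by
          rw [DFinsupp.mk_apply, dif_pos (by simpa using hi)]
        rw [this, sub_self]
        exact zero_mem _
    intro j
    rw [hπL] at h₀
    by_cases hj : j ∈ s.support
    · exact Ideal.Quotient.eq_zero_iff_mem.1
        (linearIndependent_iff'.1 b.linearIndependent s.support _ h₀ j hj)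
    · rw [Finsupp.notMem_support_iff.1 hj]
      exact zero_mem _
  have hcoeff : ∀ n d c, Φ (d, c) ∈ (I ^ n • ⊤ : Submodule R (∀ i, R ⧸ a i)) →
      ∀ j, c j ∈ I ^ n := by
    intro n d c
    induction n with
    | zero => simp
    | succ n ih =>
      intro h
      let T : Set ι := {i | a i ≤ I ^ (n + 1) ∧ d i = 0}
      have hT : Tᶜ.Finite := by
        refine ((ha (n + 1) (by simp)).union d.support.finite_toSet).subset fun i hi => ?_
        by_cases h' : a i ≤ I ^ (n + 1)
        · right
          simpa using fun hd => hi ⟨h', hd⟩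
        · exact Or.inl h'
      refine IsLocalRing.mem_maximalIdeal_pow_of_sum_mul_mem (fun j (t : T) => r j t)
        (hindep T hT) n c ?_
        (ih (Submodule.smul_mono_left (Ideal.pow_le_pow_right n.le_succ) h))
      rintro ⟨i, hi, hdi⟩
      have h' := Submodule.map_mem_smul_top
        (LinearMap.proj (R := R) (φ := fun i => R ⧸ a i) i) h
      have h'' : Φ (d, c) i = Ideal.Quotient.mk (a i) (c.sum fun j c => c * r j i) := by
        rw [← hL, LinearMap.coprod_apply]
        change d i + L c i = L c i
        rw [hdi, zero_add]
      rw [LinearMap.proj_apply, h''] at h'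
      have := Ideal.Quotient.mkQ_mem_smul_top_iff.1 h'
      rwa [sup_eq_right.2 hi] at this
  have hinj : ∀ n x, Φ x ∈ (I ^ n • ⊤ : Submodule R (∀ i, R ⧸ a i)) →
      x ∈ (I ^ n • ⊤ : Submodule R ((Π₀ i, R ⧸ a i) × (_ →₀ R))) := by
    rintro n ⟨d, c⟩ h
    have hc := Finsupp.mem_smul_top c (hcoeff n d c h)
    have hd : incl d ∈ (I ^ n • ⊤ : Submodule R (∀ i, R ⧸ a i)) := by
      have := sub_mem h (Submodule.map_mem_smul_top L hc)
      rwa [LinearMap.coprod_apply, add_sub_cancel_right] at this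
    have hd' := DFinsupp.mem_smul_top d fun i => Submodule.map_mem_smul_top
      (LinearMap.proj (R := R) (φ := fun i => R ⧸ a i) i) hd
    have := add_mem (Submodule.map_mem_smul_top (LinearMap.inl R _ (_ →₀ R)) hd')
      (Submodule.map_mem_smul_top (LinearMap.inr R (Π₀ i, R ⧸ a i) _) hc)
    simpa using this
  let E := LinearEquiv.ofBijective (AdicCompletion.map I Φ)
    (AdicCompletion.map_bijective hinj hsurj)
  refine ⟨(AdicCompletion.map I (LinearMap.fst R _ _) ∘ₗ E.symm.toLinearMap).restrictScalars R,
    fun x => ?_⟩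
  have hx : AdicCompletion.map I incl x =
      E (AdicCompletion.map I (LinearMap.inl R _ _) x) := by
    change _ = AdicCompletion.map I Φ _
    rw [AdicCompletion.map_comp_apply, LinearMap.coprod_inl]
  change AdicCompletion.map I (LinearMap.fst R _ _) (E.symm (AdicCompletion.map I incl x)) = x
  rw [hx, E.symm_apply_apply, AdicCompletion.map_comp_apply, LinearMap.fst_comp_inl,
    AdicCompletion.map_id]
  rfl

end PureInjective

/-- A direct sum of cyclic modules `R ⧸ a i`, for ideals `a i` converging to zero in the `𝔪`-adic
topology, has a pure-injective completion. -/
theorem isPureInjective_adicCompletion_dfinsupp_quotient {R : Type u} [CommRing R]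
    [IsNoetherianRing R] [IsLocalRing R] (a : ℕ → Ideal R)
    (ha : ∀ n : ℕ, 1 ≤ n → {i | ¬ a i ≤ maximalIdeal R ^ n}.Finite) :
    IsPureInjective R (AdicCompletion (maximalIdeal R) (Π₀ i, R ⧸ a i)) := by
  intro Y _ _ f hf
  let I := maximalIdeal R
  obtain ⟨g, hg⟩ := AdicCompletion.exists_retraction_map_coeFnLinearMap a ha
  let v := AdicCompletion.map I
    (DFinsupp.coeFnLinearMap R : (Π₀ i, R ⧸ a i) →ₗ[R] ∀ i, R ⧸ a i)
  let P := LinearEquiv.ofBijective (AdicCompletion.pi I fun i => R ⧸ a i)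
    (AdicCompletion.pi_bijective _ (IsNoetherian.noetherian I))
  choose h hh using fun i => hf.exists_adicCompletion_extension
    ((LinearMap.proj i ∘ₗ P.toLinearMap ∘ₗ v).restrictScalars R)
  refine ⟨g ∘ₗ (P.symm.toLinearMap.restrictScalars R) ∘ₗ LinearMap.pi h,
    LinearMap.ext fun x => ?_⟩
  have : LinearMap.pi h (f x) = P (v x) := funext fun i => LinearMap.congr_fun (hh i) x
  change g (P.symm (LinearMap.pi h (f x))) = x
  rw [this, P.symm_apply_apply]
  exact hg x

/-- If `(𝔞 i)` is a sequence of ideals such that for each `n ≥ 1` one has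
`𝔞 i ⊆ 𝔪^n` for all but finitely many `i`, then the completion of `⊕ R/𝔞 i` is
pure-injective; in particular this holds for `⊕_{i≥1} R/𝔪^i`. -/
theorem completion_sum_quotients_pureInjective (R : Type u) [CommRing R] [IsNoetherianRing R]
    [IsLocalRing R] (a : ℕ → Ideal R)
    (ha : ∀ n : ℕ, 1 ≤ n → {i : ℕ | ¬ a i ≤ maximalIdeal R ^ n}.Finite) :
    IsPureInjective R (AdicCompletion (maximalIdeal R) (Π₀ i : ℕ, R ⧸ a i)) ∧
      IsPureInjective R
        (AdicCompletion (maximalIdeal R) (Π₀ i : ℕ, R ⧸ (maximalIdeal R ^ (i + 1)))) := by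
  refine ⟨isPureInjective_adicCompletion_dfinsupp_quotient a ha,
    isPureInjective_adicCompletion_dfinsupp_quotient _ fun n _ =>
      (Set.finite_lt_nat n).subset fun i hi => ?_⟩
  by_contra hin
  exact hi (Ideal.pow_le_pow_right ((not_lt.1 hin).trans i.le_succ))
end

section
/- Let $A \subseteq B$ be a strictly pure-essential extension of $R$-modules and let $A \subseteq B_1 \subseteq B$ be an intermediate module such that $B_1$ is pure in $B$. Then both $A \subseteq B_1$ and $B_1 \subseteq B$ are strictly pure-essential extensions. -/
/- Throughout, `(R, 𝔪)` is a commutative noetherian local ring and all modules are `R`-modules.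
`AdicCompletion (maximalIdeal R) M` is the `𝔪`-adic completion `lim M/𝔪^n M` and
`IsHausdorff (maximalIdeal R) M` says that `M` is (`𝔪`-adically) separated. -/

open TensorProduct IsLocalRing

universe u

section PureMono

variable {R : Type u} [CommRing R] {M N Y P : Type u}
  [AddCommGroup M] [Module R M] [AddCommGroup N] [Module R N]
  [AddCommGroup Y] [Module R Y] [AddCommGroup P] [Module R P]

theorem IsPureMono.comp {f : M →ₗ[R] N} {g : N →ₗ[R] P} (hg : IsPureMono R g)
    (hf : IsPureMono R f) : IsPureMono R (g ∘ₗ f) := by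
  refine ⟨hg.1.comp hf.1, fun X _ _ => ?_⟩
  rw [LinearMap.lTensor_comp, LinearMap.coe_comp]
  exact (hg.2 X).comp (hf.2 X)

theorem IsPureMono.of_comp {f : M →ₗ[R] N} {g : N →ₗ[R] P}
    (h : IsPureMono R (g ∘ₗ f)) : IsPureMono R f := by
  refine ⟨Function.Injective.of_comp (f := g) h.1, fun X _ _ => ?_⟩
  have hX := h.2 X
  rw [LinearMap.lTensor_comp, LinearMap.coe_comp] at hX
  exact hX.of_comp

theorem LinearEquiv.isPureMono (e : M ≃ₗ[R] N) : IsPureMono R (e : M →ₗ[R] N) :=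
  ⟨e.injective, fun X _ _ => (e.lTensor X).injective⟩

/-- Pure monomorphisms are stable under pushout; the pushout square is expressed by right
exactness of `M → N × Y → P → 0`. -/
theorem IsPureMono.of_exact_prod {f : M →ₗ[R] N} {g : M →ₗ[R] Y} {f' : Y →ₗ[R] P}
    {g' : N →ₗ[R] P} (hf : IsPureMono R f)
    (hex : Function.Exact (f.prod (-g)) (g'.coprod f'))
    (hsurj : Function.Surjective (g'.coprod f')) : IsPureMono R f' := by
  refine ⟨(injective_iff_map_eq_zero f').2 fun y hy => ?_, fun X _ _ =>
    (injective_iff_map_eq_zero _).2 fun y hy => ?_⟩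
  · obtain ⟨m, hm⟩ := (hex (0, y)).1 (by simp [hy])
    obtain ⟨h1, h2⟩ := Prod.ext_iff.1 hm
    have : m = 0 := hf.1 (by simpa using h1)
    simpa [this] using h2.symm
  · have hX := lTensor_exact X hex hsurj
    obtain ⟨m, hm⟩ := (hX ((LinearMap.inr R N Y).lTensor X y)).1 (by
      rw [← LinearMap.lTensor_comp_apply, LinearMap.coprod_inr, hy])
    have h1 := congrArg ((LinearMap.fst R N Y).lTensor X) hm
    have h2 := congrArg ((LinearMap.snd R N Y).lTensor X) hm
    rw [← LinearMap.lTensor_comp_apply, ← LinearMap.lTensor_comp_apply, LinearMap.fst_prod,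
      LinearMap.fst_comp_inr, LinearMap.lTensor_zero, LinearMap.zero_apply] at h1
    rw [← LinearMap.lTensor_comp_apply, ← LinearMap.lTensor_comp_apply,
      LinearMap.snd_comp_inr, LinearMap.lTensor_id, LinearMap.id_apply] at h2
    have hm0 : m = 0 := hf.2 X (by rw [h1, map_zero])
    rw [← h2, hm0, map_zero]

theorem IsPureMono.mapQ_subtype {B₁ : Submodule R N} (h : IsPureMono R B₁.subtype)
    (X : Submodule R B₁) :
    IsPureMono R (X.mapQ (X.map B₁.subtype) B₁.subtype (Submodule.le_comap_map _ _)) := by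
  refine h.of_exact_prod (g := X.mkQ) (g' := (X.map B₁.subtype).mkQ) ?_ ?_
  · rintro ⟨b, y⟩
    obtain ⟨c, rfl⟩ := X.mkQ_surjective y
    constructor
    · intro hb
      have hbc : b + c ∈ X.map B₁.subtype := by
        rw [← Submodule.Quotient.mk_eq_zero]
        simpa using hb
      obtain ⟨x, hx, hxe⟩ := hbc
      have hxb : b = ((x - c : B₁) : N) := by
        rw [AddSubgroupClass.coe_sub, eq_sub_iff_add_eq]
        exact hxe.symm
      refine ⟨x - c, Prod.ext hxb.symm ?_⟩
      simpa using hx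
    · rintro ⟨m, hm⟩
      rw [← hm]
      simp
  · intro p
    obtain ⟨b, rfl⟩ := (X.map B₁.subtype).mkQ_surjective p
    exact ⟨(b, 0), by simp⟩

end PureMono

/-- If `A ⊆ B` is strictly pure-essential and `A ⊆ B₁ ⊆ B` with `B₁` pure
in `B`, then `A ⊆ B₁` and `B₁ ⊆ B` are strictly pure-essential. -/
theorem strictlyPureEssential_of_intermediate (R : Type u) [CommRing R] [IsNoetherianRing R]
    [IsLocalRing R] (B : Type u) [AddCommGroup B] [Module R B]
    (A B₁ : Submodule R B) (hAB₁ : A ≤ B₁)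
    (hA : IsStrictlyPureEssential R A) (hB₁ : IsPureMono R B₁.subtype) :
    IsStrictlyPureEssential R (A.comap B₁.subtype) ∧ IsStrictlyPureEssential R B₁ := by
  obtain ⟨⟨hApure, hAess⟩, hAstrict⟩ := hA
  let ι : A →ₗ[R] B₁ := Submodule.inclusion hAB₁
  let e : A.comap B₁.subtype ≃ₗ[R] A := Submodule.comapSubtypeEquivOfLe hAB₁
  have hι : IsPureMono R ι := IsPureMono.of_comp (g := B₁.subtype) hApure
  refine ⟨⟨⟨hι.comp e.isPureMono, fun X hXA hX => ?_⟩, fun Y _ _ g hg hgA => ?_⟩,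
    ⟨⟨hB₁, fun X hXB hX => ?_⟩, fun Y _ _ g hg hgB => ?_⟩⟩
  · refine Submodule.map_injective_of_injective B₁.injective_subtype
      ((hAess (X.map B₁.subtype) ?_ ?_).trans (Submodule.map_bot _).symm)
    · rw [Submodule.map_inf_eq_map_inf_comap, hXA, Submodule.map_bot]
    · exact (hB₁.mapQ_subtype X).comp (hX.comp e.symm.isPureMono)
  · let h : B₁ →ₗ[R] B × Y := B₁.subtype.prod (-g)
    let q := (LinearMap.range h).mkQ
    let g' := q ∘ₗ LinearMap.inl R B Y
    let f' := q ∘ₗ LinearMap.inr R B Y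
    have hq : g'.coprod f' = q := by
      rw [← LinearMap.comp_coprod, LinearMap.coprod_inl_inr, LinearMap.comp_id]
    have hf' : IsPureMono R f' := hB₁.of_exact_prod (g := g) (g' := g')
      (by rw [hq]; exact LinearMap.exact_map_mkQ_range h)
      (by rw [hq]; exact Submodule.mkQ_surjective _)
    have hcomm : g' ∘ₗ B₁.subtype = f' ∘ₗ g := by
      ext b
      refine (Submodule.Quotient.eq _).2 ⟨b, ?_⟩
      simp [h]
    have hg' : Function.Injective g' := (injective_iff_map_eq_zero g').2 fun b hb => by
      obtain ⟨c, hc⟩ := (Submodule.Quotient.mk_eq_zero _).1 hb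
      obtain ⟨h1, h2⟩ := Prod.ext_iff.1 hc
      have hc0 : c = 0 := hg (by simpa [h] using h2)
      simpa [h, hc0] using h1.symm
    have hpure : IsPureMono R (g' ∘ₗ A.subtype) := by
      have : g' ∘ₗ A.subtype = (g' ∘ₗ B₁.subtype) ∘ₗ ι := rfl
      rw [this, hcomm]
      exact hf'.comp (hgA.comp e.symm.isPureMono)
    exact IsPureMono.of_comp (g := f') (hcomm ▸ (hAstrict _ g' hg' hpure).comp hB₁)
  · exact hAess X (le_bot_iff.1 ((inf_le_inf_left X hAB₁).trans hXB.le)) (hX.comp hι)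
  · exact hAstrict Y g hg (hgB.comp hι)
end

section
/- Let $(M_i)_{i\in I}$ be a family of $R$-modules, $M = \bigoplus_{i\in I} M_i$, $P = \prod_{i\in I} M_i$, and $A = \bigcap_{n\ge 1}(M + \mathfrak m^n P)$. Let $\mathfrak b$ be an ideal of $R$ for which there exists $e \ge 1$ with $\mathfrak m^f M \cap \mathfrak b M \subseteq \mathfrak m^{f-e}\mathfrak b M$ for all $f \ge e$. Then $A \cap \mathfrak b P \subseteq \mathfrak b A + H(P)$, where $H(P) = \bigcap_{n\ge 1}\mathfrak m^n P$. -/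
/- Throughout, `(R, 𝔪)` is a commutative noetherian local ring and all modules are `R`-modules.
`AdicCompletion (maximalIdeal R) M` is the `𝔪`-adic completion `lim M/𝔪^n M` and
`IsHausdorff (maximalIdeal R) M` says that `M` is (`𝔪`-adically) separated. -/

open TensorProduct IsLocalRing

universe u

theorem Submodule.exists_eq_sum_of_mem_span_range_smul {R N κ : Type*} [CommRing R]
    [AddCommGroup N] [Module R N] [Fintype κ] (g : κ → R) (S : Submodule R N) {x : N}
    (hx : x ∈ Ideal.span (Set.range g) • S) :
    ∃ q : κ → N, (∀ j, q j ∈ S) ∧ x = ∑ j, g j • q j := by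
  induction hx using Submodule.smul_induction_on' with
  | smul r hr n hn =>
    obtain ⟨c, rfl⟩ := (Submodule.mem_span_range_iff_exists_fun R).1 hr
    refine ⟨fun j => c j • n, fun j => S.smul_mem _ hn, ?_⟩
    rw [Finset.sum_smul]
    exact Finset.sum_congr rfl fun j _ => by rw [smul_smul, smul_eq_mul, mul_comm]
  | add x _ y _ hx hy =>
    obtain ⟨q, hq, rfl⟩ := hx
    obtain ⟨q', hq', rfl⟩ := hy
    exact ⟨q + q', fun j => S.add_mem (hq j) (hq' j), by
      simp [smul_add, Finset.sum_add_distrib]⟩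

theorem Ideal.FG.exists_fin_span_range {R : Type*} [CommRing R] {I : Ideal R} (hI : I.FG) :
    ∃ (k : ℕ) (g : Fin k → R), Ideal.span (Set.range g) = I :=
  Submodule.fg_iff_exists_fin_generating_family.1 hI

theorem Submodule.apply_mem_smul_top {R ι : Type*} [CommRing R] {M : ι → Type*}
    [∀ i, AddCommGroup (M i)] [∀ i, Module R (M i)] (I : Ideal R) {x : (i : ι) → M i}
    {S : Submodule R ((i : ι) → M i)} (hx : x ∈ I • S) (i : ι) :
    x i ∈ I • (⊤ : Submodule R (M i)) := by
  have h := Submodule.mem_map_of_mem (f := LinearMap.proj (R := R) (φ := M) i) hx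
  rw [Submodule.map_smul''] at h
  exact Submodule.smul_mono (le_refl I) le_top h

theorem Submodule.mem_smul_top_pi_iff {R ι : Type*} [CommRing R] {M : ι → Type*}
    [∀ i, AddCommGroup (M i)] [∀ i, Module R (M i)] {I : Ideal R} (hI : I.FG)
    {x : (i : ι) → M i} :
    x ∈ I • (⊤ : Submodule R ((i : ι) → M i)) ↔ ∀ i, x i ∈ I • (⊤ : Submodule R (M i)) := by
  refine ⟨Submodule.apply_mem_smul_top I, fun h => ?_⟩
  obtain ⟨k, g, rfl⟩ := hI.exists_fin_span_range
  choose q _ hq using fun i => Submodule.exists_eq_sum_of_mem_span_range_smul g _ (h i)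
  have hx : x = ∑ j, g j • fun i => q i j := by
    ext i
    simpa using hq i
  rw [hx]
  exact Submodule.sum_mem _ fun j _ =>
    Submodule.smul_mem_smul (Ideal.subset_span ⟨j, rfl⟩) Submodule.mem_top

theorem Submodule.mem_iSup_range_single_iff {R ι : Type*} [CommRing R] [DecidableEq ι]
    {M : ι → Type*} [∀ i, AddCommGroup (M i)] [∀ i, Module R (M i)] {x : (i : ι) → M i} :
    x ∈ (⨆ i, LinearMap.range (LinearMap.single R M i)) ↔ {i | x i ≠ 0}.Finite := by
  refine ⟨fun h => ?_, fun h => ?_⟩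
  · induction h using Submodule.iSup_induction' with
    | mem i x hx =>
      obtain ⟨m, rfl⟩ := hx
      refine (Set.finite_singleton i).subset fun j hj => ?_
      by_contra hji
      exact hj (by simpa using Pi.single_eq_of_ne hji m)
    | zero => simp
    | add x y _ _ hx hy =>
      refine (hx.union hy).subset fun i hi => ?_
      by_contra hn
      simp only [Set.mem_union, Set.mem_ofPred_eq, not_or, not_not] at hn
      exact hi (by simp [hn.1, hn.2])
  · have hx : x = ∑ i ∈ h.toFinset, LinearMap.single R M i (x i) := by
      ext j
      by_cases hj : x j = 0 <;> simp [Finset.sum_apply, Finset.sum_pi_single, hj]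
    rw [hx]
    exact Submodule.sum_mem _ fun i _ => Submodule.mem_iSup_of_mem i ⟨_, rfl⟩

theorem Submodule.mem_iSup_range_single_sup_smul_top_iff {R ι : Type*} [CommRing R]
    [DecidableEq ι] {M : ι → Type*} [∀ i, AddCommGroup (M i)] [∀ i, Module R (M i)]
    {I : Ideal R} (hI : I.FG) {x : (i : ι) → M i} :
    x ∈ (⨆ i, LinearMap.range (LinearMap.single R M i)) ⊔ I • ⊤ ↔
      {i | x i ∉ I • (⊤ : Submodule R (M i))}.Finite := by
  classical
  refine ⟨fun h => ?_, fun h => ?_⟩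
  · obtain ⟨y, hy, z, hz, rfl⟩ := Submodule.mem_sup.1 h
    refine (Submodule.mem_iSup_range_single_iff.1 hy).subset fun i hi hyi => hi ?_
    simpa [hyi] using Submodule.apply_mem_smul_top I hz i
  · let z : (i : ι) → M i := fun i => if x i ∈ I • (⊤ : Submodule R (M i)) then x i else 0
    rw [← sub_add_cancel x z]
    refine Submodule.add_mem_sup (Submodule.mem_iSup_range_single_iff.2 (h.subset ?_))
      ((Submodule.mem_smul_top_pi_iff hI).2 fun i => ?_)
    · intro i hi hxi
      exact hi (by simp [z, hxi])
    · by_cases hxi : x i ∈ I • (⊤ : Submodule R (M i)) <;> simp [z, hxi]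

/-- An Artin–Rees type inclusion for the direct sum restricts to each summand. -/
theorem Submodule.inf_smul_top_le_of_iSup_range_single {R ι : Type*} [CommRing R]
    [DecidableEq ι] {M : ι → Type*} [∀ i, AddCommGroup (M i)] [∀ i, Module R (M i)]
    {I J K : Ideal R} {S : Submodule R ((i : ι) → M i)}
    (hS : S = ⨆ i, LinearMap.range (LinearMap.single R M i))
    (h : I • S ⊓ J • S ≤ K • S) (i : ι) :
    I • (⊤ : Submodule R (M i)) ⊓ J • (⊤ : Submodule R (M i)) ≤ K • ⊤ := by
  have key (L : Ideal R) {m : M i} (hm : m ∈ L • (⊤ : Submodule R (M i))) :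
      LinearMap.single R M i m ∈ L • S := by
    have := Submodule.mem_map_of_mem (f := LinearMap.single R M i) hm
    rw [Submodule.map_smul'', Submodule.map_top] at this
    exact Submodule.smul_mono (le_refl L)
      (hS ▸ le_iSup (fun i => LinearMap.range (LinearMap.single R M i)) i) this
  rintro m ⟨hI, hJ⟩
  simpa using Submodule.apply_mem_smul_top K (h ⟨key I hI, key J hJ⟩) i

/-- If an element of a module lies in `b • ⊤`, its coefficients on generators of `b` can be
chosen as deep in the `I`-adic filtration as an Artin–Rees inclusion permits, up to an error in
the intersection of the filtration. -/
theorem Submodule.exists_sum_smul_of_forall_inf_le {R N κ : Type*} [CommRing R] [AddCommGroup N]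
    [Module R N] [Fintype κ] (I : Ideal R) (g : κ → R) (e : ℕ)
    (h : ∀ f, e ≤ f → I ^ f • (⊤ : Submodule R N) ⊓ Ideal.span (Set.range g) • ⊤ ≤
      (I ^ (f - e) * Ideal.span (Set.range g)) • ⊤)
    {x : N} (hx : x ∈ Ideal.span (Set.range g) • (⊤ : Submodule R N)) :
    ∃ q : κ → N, (∀ n, x - ∑ j, g j • q j ∈ I ^ n • (⊤ : Submodule R N)) ∧
      ∀ n j, x ∈ I ^ (n + e) • (⊤ : Submodule R N) → q j ∈ I ^ n • (⊤ : Submodule R N) := by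
  classical
  by_cases hH : ∀ n, x ∈ I ^ n • (⊤ : Submodule R N)
  · exact ⟨0, by simpa using hH, by simp⟩
  push Not at hH
  have anti {a c : ℕ} (hac : a ≤ c) : I ^ c • (⊤ : Submodule R N) ≤ I ^ a • ⊤ :=
    Submodule.smul_mono_left (Ideal.pow_le_pow_right hac)
  obtain ⟨f, hf, hmax⟩ : ∃ f, x ∈ I ^ f • (⊤ : Submodule R N) ∧
      ∀ n, x ∈ I ^ n • (⊤ : Submodule R N) → n ≤ f := by
    have hpos : Nat.find hH ≠ 0 := fun h0 => Nat.find_spec hH (by simp [h0])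
    refine ⟨Nat.find hH - 1, not_not.1 (Nat.find_min hH (by omega)), fun n hn => ?_⟩
    by_contra hlt
    exact Nat.find_spec hH (anti (by omega) hn)
  have hmem : x ∈ Ideal.span (Set.range g) • (I ^ (f - e) • (⊤ : Submodule R N)) := by
    by_cases hef : e ≤ f
    · rw [← mul_smul, mul_comm]
      exact h f hef ⟨hf, hx⟩
    · simpa [Nat.sub_eq_zero_of_le (not_le.1 hef).le] using hx
  obtain ⟨q, hq, hxq⟩ := Submodule.exists_eq_sum_of_mem_span_range_smul g _ hmem
  refine ⟨q, fun n => by simp [← hxq], fun n j hn => anti ?_ (hq j)⟩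
  have := hmax _ hn
  omega

/-- With `M = ⊕ M i ⊆ P = ∏ M i` and `A = ⋂_{n ≥ 1} (M + 𝔪^n P)`: if for
the ideal `𝔟` there is `e ≥ 1` with `𝔪^f M ∩ 𝔟 M ⊆ 𝔪^(f-e) 𝔟 M` for all `f ≥ e`, then
`A ∩ 𝔟 P ⊆ 𝔟 A + H(P)` where `H(P) = ⋂_{n ≥ 1} 𝔪^n P`. -/
theorem closure_inter_smul (R : Type u) [CommRing R] [IsNoetherianRing R] [IsLocalRing R]
    {ι : Type u} [DecidableEq ι] (M : ι → Type u)
    [∀ i, AddCommGroup (M i)] [∀ i, Module R (M i)]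
    (Md A HP : Submodule R ((i : ι) → M i))
    (hMd : Md = ⨆ i, LinearMap.range (LinearMap.single R M i))
    (hA : A = ⨅ (n : ℕ) (_ : 1 ≤ n), (Md ⊔ maximalIdeal R ^ n • ⊤))
    (hHP : HP = ⨅ (n : ℕ) (_ : 1 ≤ n),
      (maximalIdeal R ^ n • (⊤ : Submodule R ((i : ι) → M i))))
    (b : Ideal R) (e : ℕ) (he : 1 ≤ e)
    (hb : ∀ f : ℕ, e ≤ f →
      (maximalIdeal R ^ f • Md) ⊓ (b • Md) ≤ (maximalIdeal R ^ (f - e) * b) • Md) :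
    A ⊓ b • (⊤ : Submodule R ((i : ι) → M i)) ≤ b • A ⊔ HP := by
  obtain ⟨k, g, rfl⟩ := Ideal.FG.exists_fin_span_range (IsNoetherian.noetherian b)
  have fg (n : ℕ) : (maximalIdeal R ^ n).FG := IsNoetherian.noetherian _
  rintro x ⟨hxA, hxb⟩
  choose q hq hqn using fun i => Submodule.exists_sum_smul_of_forall_inf_le (maximalIdeal R) g e
    (fun f hf => Submodule.inf_smul_top_le_of_iSup_range_single hMd (hb f hf) i)
    (Submodule.apply_mem_smul_top _ hxb i)
  subst hMd hA hHP
  simp only [SetLike.mem_coe, Submodule.mem_iInf,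
    Submodule.mem_iSup_range_single_sup_smul_top_iff (fg _)] at hxA
  rw [← add_sub_cancel (∑ j, g j • fun i => q i j) x]
  refine Submodule.add_mem_sup (Submodule.sum_mem _ fun j _ =>
    Submodule.smul_mem_smul (Ideal.subset_span ⟨j, rfl⟩) ?_) ?_
  · simp only [Submodule.mem_iInf, Submodule.mem_iSup_range_single_sup_smul_top_iff (fg _)]
    exact fun n hn => (hxA (n + e) (by omega)).subset fun i hi hxi => hi (hqn i n j hxi)
  · simp only [Submodule.mem_iInf, Submodule.mem_smul_top_pi_iff (fg _)]
    intro n _ i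
    simpa using hq i n
end
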